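/- For every integer k ≥ 2, q(K_1 ∨ ((k−2)P_2 ∪ S_4 ∪ P_1)) > q(K_1 ∨ ((k−2)P_2 ∪ P_4 ∪ P_1)). -/

import Mathlib

namespace QPaper

open SimpleGraph

/-- The signless Laplacian matrix `Q(G) = D(G) + A(G)` of a graph, over `ℝ`. -/
noncomputable def signlessLap {V : Type*} [Fintype V] [DecidableEq V] (G : SimpleGraph V) :
    Matrix V V ℝ :=
  letI := Classical.decRel G.Adj
  G.degMatrix ℝ + G.adjMatrix ℝ

/-- The `Q`-index of a graph: the largest eigenvalue of its signless Laplacian matrix. -/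
noncomputable def qIndex {V : Type*} [Fintype V] [DecidableEq V] (G : SimpleGraph V) : ℝ :=
  sSup (spectrum ℝ (signlessLap G))

/-- The number of edges (size) of a graph. -/
noncomputable def numEdges {V : Type*} (G : SimpleGraph V) : ℕ :=
  Nat.card G.edgeSet

/-- The degree of a vertex. -/
noncomputable def deg {V : Type*} (G : SimpleGraph V) (v : V) : ℕ :=
  Nat.card (G.neighborSet v)

/-- A graph is `2` leaves-free if it has at most one vertex of degree one. -/
def TwoLeavesFree {V : Type*} (G : SimpleGraph V) : Prop :=
  ∀ u v : V, deg G u = 1 → deg G v = 1 → u = v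

/-- The maximum degree `Δ(G)`. -/
noncomputable def maxDeg {V : Type*} [Fintype V] (G : SimpleGraph V) : ℕ :=
  letI := Classical.decEq V
  letI := Classical.decRel G.Adj
  G.maxDegree

/-- `k` disjoint copies of `P₂`, i.e. a perfect matching on `2k` vertices. -/
def matching (k : ℕ) : SimpleGraph (Fin k × Fin 2) :=
  SimpleGraph.fromRel (fun a b => a.1 = b.1)

/-- The star graph `Sₙ` on `n` vertices (`K_{1,n-1}` with center `0`). -/
def starGraph (n : ℕ) : SimpleGraph (Fin n) :=
  SimpleGraph.fromRel (fun a _ => (a : ℕ) = 0)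

/-- Disjoint union of two graphs. -/
def dUnion {α β : Type*} (G : SimpleGraph α) (H : SimpleGraph β) : SimpleGraph (α ⊕ β) :=
  SimpleGraph.fromRel (fun a b =>
    (∃ x y, a = Sum.inl x ∧ b = Sum.inl y ∧ G.Adj x y) ∨
    (∃ x y, a = Sum.inr x ∧ b = Sum.inr y ∧ H.Adj x y))

/-- The join `K₁ ∨ H` : a new vertex (`none`) adjacent to every vertex of `H`. -/
def cone {α : Type*} (H : SimpleGraph α) : SimpleGraph (Option α) :=
  SimpleGraph.fromRel (fun a b =>
    a = none ∨ ∃ x y, a = some x ∧ b = some y ∧ H.Adj x y)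

open scoped Classical in
theorem signlessLap_mulVec {V : Type*} [Fintype V] [DecidableEq V] (G : SimpleGraph V)
    (v : V → ℝ) (i : V) :
    (signlessLap G).mulVec v i = ∑ j, if G.Adj i j then v i + v j else 0 := by
  simp only [signlessLap, Matrix.add_mulVec, Pi.add_apply, SimpleGraph.degMatrix,
    Matrix.mulVec_diagonal, SimpleGraph.adjMatrix_mulVec_apply]
  rw [← Finset.sum_filter, Finset.sum_add_distrib, Finset.sum_const, nsmul_eq_mul,
    ← SimpleGraph.card_neighborFinset_eq_degree]
  congr! <;> ext <;> simp

theorem signlessLap_nonneg {V : Type*} [Fintype V] [DecidableEq V] (G : SimpleGraph V)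
    (i j : V) : 0 ≤ signlessLap G i j := by
  classical
  simp only [signlessLap, Matrix.add_apply, SimpleGraph.degMatrix, Matrix.diagonal_apply,
    SimpleGraph.adjMatrix_apply]
  positivity

theorem signlessLap_isHermitian {V : Type*} [Fintype V] [DecidableEq V] (G : SimpleGraph V) :
    (signlessLap G).IsHermitian := by
  let _ := Classical.decRel G.Adj
  exact (Matrix.isHermitian_diagonal _).add (G.isSymm_adjMatrix (α := ℝ))

/-- A positive vector `v` with `Q v ≤ c v` bounds the `Q`-index by `c`. -/
theorem qIndex_le_of_mulVec_le {V : Type*} [Fintype V] [DecidableEq V] {G : SimpleGraph V}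
    {v : V → ℝ} {c : ℝ} (hc : 0 ≤ c) (hv : ∀ i, 0 < v i)
    (h : ∀ i, (signlessLap G).mulVec v i ≤ c * v i) : qIndex G ≤ c := by
  refine Real.sSup_le (fun μ hμ => ?_) hc
  rw [← Matrix.spectrum_toLin', ← Module.End.hasEigenvalue_iff_mem_spectrum] at hμ
  obtain ⟨x, hx⟩ := hμ.exists_hasEigenvector
  have hμx : (signlessLap G).mulVec x = μ • x := by simpa using hx.apply_eq_smul
  obtain ⟨i₀, hi₀⟩ := Function.ne_iff.1 hx.2
  obtain ⟨i, -, hi⟩ := Finset.exists_max_image Finset.univ (fun i => |x i| / v i) ⟨i₀, by simp⟩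
  have hpos : 0 < |x i| / v i :=
    (div_pos (abs_pos.2 hi₀) (hv i₀)).trans_le (hi i₀ (Finset.mem_univ _))
  have hle : ∀ j, |x j| ≤ |x i| / v i * v j := fun j =>
    (div_le_iff₀ (hv j)).1 (hi j (Finset.mem_univ _))
  have hxi : |x i| / v i * v i = |x i| := div_mul_cancel₀ _ (hv i).ne'
  have hxi0 : 0 < |x i| := hxi ▸ mul_pos hpos (hv i)
  have key : |μ| * |x i| ≤ c * |x i| := calc
    |μ| * |x i| = |∑ j, signlessLap G i j * x j| := by
      rw [← abs_mul, ← smul_eq_mul, ← Pi.smul_apply, ← hμx]; rfl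
    _ ≤ ∑ j, signlessLap G i j * |x j| := (Finset.abs_sum_le_sum_abs _ _).trans_eq
      (Finset.sum_congr rfl fun j _ => by rw [abs_mul, abs_of_nonneg (signlessLap_nonneg G i j)])
    _ ≤ ∑ j, signlessLap G i j * (|x i| / v i * v j) := Finset.sum_le_sum fun j _ =>
      mul_le_mul_of_nonneg_left (hle j) (signlessLap_nonneg G i j)
    _ = |x i| / v i * (signlessLap G).mulVec v i := by
      simp only [Matrix.mulVec, dotProduct, Finset.mul_sum]
      exact Finset.sum_congr rfl fun j _ => by ring
    _ ≤ |x i| / v i * (c * v i) := mul_le_mul_of_nonneg_left (h i) hpos.le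
    _ = c * |x i| := by rw [mul_left_comm, hxi]
  exact (le_abs_self μ).trans (le_of_mul_le_mul_right key hxi0)

/-- The Rayleigh quotient of any vector is at most the `Q`-index. -/
theorem dotProduct_mulVec_le_qIndex {V : Type*} [Fintype V] [DecidableEq V] (G : SimpleGraph V)
    (v : V → ℝ) : v ⬝ᵥ (signlessLap G).mulVec v ≤ qIndex G * (v ⬝ᵥ v) := by
  have hps : (algebraMap ℝ (Matrix V V ℝ) (qIndex G) - signlessLap G).PosSemidef := by
    refine Matrix.posSemidef_iff_isHermitian_and_spectrum_nonneg.2 ⟨?_, fun μ hμ => ?_⟩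
    · refine Matrix.IsHermitian.sub ?_ (signlessLap_isHermitian G)
      rw [Matrix.algebraMap_eq_diagonal]
      exact Matrix.isHermitian_diagonal _
    · rw [← spectrum.singleton_sub_eq] at hμ
      obtain ⟨_, rfl, ν, hν, rfl⟩ := hμ
      exact sub_nonneg.2 (le_csSup (Matrix.finite_real_spectrum).bddAbove hν)
  have := hps.dotProduct_mulVec_nonneg v
  rw [Matrix.sub_mulVec, Algebra.algebraMap_eq_smul_one, Matrix.smul_mulVec, Matrix.one_mulVec,
    dotProduct_sub, dotProduct_smul, smul_eq_mul, star_trivial] at this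
  linarith

/-- A positive vector `v` with `c v ≤ Q v`, strictly in some coordinate, forces `c < q(G)`. -/
theorem lt_qIndex_of_le_mulVec {V : Type*} [Fintype V] [DecidableEq V] {G : SimpleGraph V}
    {v : V → ℝ} {c : ℝ} (hv : ∀ i, 0 < v i) (h : ∀ i, c * v i ≤ (signlessLap G).mulVec v i)
    {i₀ : V} (h₀ : c * v i₀ < (signlessLap G).mulVec v i₀) : c < qIndex G := by
  have hvv : 0 < v ⬝ᵥ v :=
    Finset.sum_pos (fun i _ => mul_pos (hv i) (hv i)) ⟨i₀, Finset.mem_univ _⟩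
  have hlt : c * (v ⬝ᵥ v) < v ⬝ᵥ (signlessLap G).mulVec v := by
    rw [dotProduct, dotProduct, Finset.mul_sum]
    refine Finset.sum_lt_sum (fun i _ => ?_) ⟨i₀, Finset.mem_univ _, ?_⟩
    · rw [mul_left_comm]; exact mul_le_mul_of_nonneg_left (h i) (hv i).le
    · rw [mul_left_comm]; exact mul_lt_mul_of_pos_left h₀ (hv i₀)
  exact lt_of_mul_lt_mul_right (hlt.trans_le (dotProduct_mulVec_le_qIndex G v)) hvv.le

section Constructions

variable {α β : Type*} [Fintype α] [DecidableEq α] [Fintype β] [DecidableEq β]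

theorem signlessLap_cone_none (H : SimpleGraph α) (v : Option α → ℝ) :
    (signlessLap (cone H)).mulVec v none = ∑ a, (v none + v (some a)) := by
  simp [signlessLap_mulVec, Fintype.sum_option, cone]

theorem signlessLap_cone_some (H : SimpleGraph α) (v : Option α → ℝ) (a : α) :
    (signlessLap (cone H)).mulVec v (some a) =
      v (some a) + v none + (signlessLap H).mulVec (fun b => v (some b)) a := by
  have h : ∀ b, (cone H).Adj (some a) (some b) ↔ H.Adj a b := fun b => by
    simp only [cone, fromRel_adj]
    grind [H.adj_comm, H.ne_of_adj]
  have h' : (cone H).Adj (some a) none := by simp [cone]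
  simp only [signlessLap_mulVec, Fintype.sum_option, if_pos h']
  refine congrArg _ (Finset.sum_congr rfl fun b _ => ?_)
  split_ifs <;> simp_all

theorem signlessLap_dUnion_inl (G : SimpleGraph α) (H : SimpleGraph β) (v : α ⊕ β → ℝ) (a : α) :
    (signlessLap (dUnion G H)).mulVec v (.inl a) =
      (signlessLap G).mulVec (fun b => v (.inl b)) a := by
  have h : ∀ b, (dUnion G H).Adj (.inl a) (.inl b) ↔ G.Adj a b := fun b => by
    simp only [dUnion, fromRel_adj]
    grind [G.adj_comm, G.ne_of_adj]
  have h' : ∀ b, ¬ (dUnion G H).Adj (.inl a) (.inr b) := fun b => by simp [dUnion]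
  simp only [signlessLap_mulVec, Fintype.sum_sum_type, h', if_false, Finset.sum_const_zero, add_zero]
  refine Finset.sum_congr rfl fun b _ => ?_
  split_ifs <;> simp_all

theorem signlessLap_dUnion_inr (G : SimpleGraph α) (H : SimpleGraph β) (v : α ⊕ β → ℝ) (a : β) :
    (signlessLap (dUnion G H)).mulVec v (.inr a) =
      (signlessLap H).mulVec (fun b => v (.inr b)) a := by
  have h : ∀ b, (dUnion G H).Adj (.inr a) (.inr b) ↔ H.Adj a b := fun b => by
    simp only [dUnion, fromRel_adj]
    grind [H.adj_comm, H.ne_of_adj]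
  have h' : ∀ b, ¬ (dUnion G H).Adj (.inr a) (.inl b) := fun b => by simp [dUnion]
  simp only [signlessLap_mulVec, Fintype.sum_sum_type, h', if_false, Finset.sum_const_zero, zero_add]
  refine Finset.sum_congr rfl fun b _ => ?_
  split_ifs <;> simp_all

end Constructions

theorem signlessLap_matching_const (m : ℕ) (y : ℝ) (a : Fin m × Fin 2) :
    (signlessLap (matching m)).mulVec (fun _ => y) a = 2 * y := by
  have h : ∀ b, (matching m).Adj a b ↔ b = (a.1, 1 - a.2) := fun b => by
    obtain ⟨i, e⟩ := a
    obtain ⟨j, f⟩ := b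
    simp only [matching, fromRel_adj, ne_eq, Prod.mk.injEq]
    fin_cases e <;> fin_cases f <;> simp [eq_comm]
  simp [signlessLap_mulVec, h, two_mul]

theorem signlessLap_pathGraph_four (v : Fin 4 → ℝ) :
    (signlessLap (pathGraph 4)).mulVec v =
      ![v 0 + v 1, (v 1 + v 0) + (v 1 + v 2), (v 2 + v 1) + (v 2 + v 3), v 3 + v 2] := by
  ext i
  fin_cases i <;> simp [signlessLap_mulVec, Fin.sum_univ_four, pathGraph_adj]

theorem signlessLap_starGraph_four (v : Fin 4 → ℝ) :
    (signlessLap (starGraph 4)).mulVec v =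
      ![(v 0 + v 1) + (v 0 + v 2) + (v 0 + v 3), v 1 + v 0, v 2 + v 0, v 3 + v 0] := by
  ext i
  fin_cases i <;> simp [signlessLap_mulVec, Fin.sum_univ_four, starGraph]

theorem signlessLap_pathGraph_one (v : Fin 1 → ℝ) (i : Fin 1) :
    (signlessLap (pathGraph 1)).mulVec v i = 0 := by
  fin_cases i
  simp [signlessLap_mulVec]

/-- The vector on `K₁ ∨ (m P₂ ∪ F ∪ P₁)`, for `F` on four vertices, equal to `1` at the apex, to
`w` on `F`, and solving the equations of an eigenvector for `t` at the remaining vertices. -/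
noncomputable def testVec (m : ℕ) (t : ℝ) (w : Fin 4 → ℝ) :
    Option ((Fin m × Fin 2) ⊕ (Fin 4 ⊕ Fin 1)) → ℝ
  | none => 1
  | some (.inl _) => 1 / (t - 3)
  | some (.inr (.inl i)) => w i
  | some (.inr (.inr _)) => 1 / (t - 1)

theorem testVec_pos {m : ℕ} {t : ℝ} {w : Fin 4 → ℝ} (ht : 3 < t) (hw : ∀ i, 0 < w i) :
    ∀ i, 0 < testVec m t w i
  | none => one_pos
  | some (.inl _) => one_div_pos.2 (by linarith)
  | some (.inr (.inl i)) => hw i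
  | some (.inr (.inr _)) => one_div_pos.2 (by linarith)

theorem signlessLap_testVec_none (m : ℕ) (t : ℝ) (w : Fin 4 → ℝ) (F : SimpleGraph (Fin 4)) :
    (signlessLap (cone (dUnion (matching m) (dUnion F (pathGraph 1))))).mulVec
      (testVec m t w) none =
      2 * m + 5 + 2 * m / (t - 3) + (w 0 + w 1 + w 2 + w 3) + 1 / (t - 1) := by
  rw [signlessLap_cone_none]
  simp [testVec, Fin.sum_univ_four]
  ring

theorem signlessLap_testVec_some {m : ℕ} {t : ℝ} (ht : 3 < t) {w : Fin 4 → ℝ}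
    {F : SimpleGraph (Fin 4)} (hF : ∀ i, w i + 1 + (signlessLap F).mulVec w i = t * w i) :
    ∀ a, (signlessLap (cone (dUnion (matching m) (dUnion F (pathGraph 1))))).mulVec
      (testVec m t w) (some a) = t * testVec m t w (some a)
  | .inl a => by
    have : t - 3 ≠ 0 := by linarith
    rw [signlessLap_cone_some, signlessLap_dUnion_inl]
    simp only [testVec]
    rw [signlessLap_matching_const]
    field_simp
    ring
  | .inr (.inl a) => by
    rw [signlessLap_cone_some, signlessLap_dUnion_inr, signlessLap_dUnion_inl]
    exact hF a
  | .inr (.inr a) => by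
    have : t - 1 ≠ 0 := by linarith
    rw [signlessLap_cone_some, signlessLap_dUnion_inr, signlessLap_dUnion_inr,
      signlessLap_pathGraph_one]
    simp only [testVec]
    field_simp
    ring

/-- The apex equation of an eigenvector of `K₁ ∨ (m P₂ ∪ P₄ ∪ P₁)` has a root `t ≥ 6`. -/
theorem exists_apex_root (m : ℕ) : ∃ t : ℝ, 6 ≤ t ∧
    2 * m + 5 + 2 * m / (t - 3) + (4 * t - 8) / (t ^ 2 - 6 * t + 7) + 1 / (t - 1) = t := by
  have hm : (0 : ℝ) ≤ m := m.cast_nonneg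
  have hcont : ContinuousOn (fun t : ℝ => 2 * m + 5 + 2 * m / (t - 3) +
      (4 * t - 8) / (t ^ 2 - 6 * t + 7) + 1 / (t - 1) - t)
      (Set.Icc (2 * m + 6) (2 * m + 10)) := by
    have h3 : ∀ t ∈ Set.Icc (2 * (m : ℝ) + 6) (2 * m + 10), t - 3 ≠ 0 := fun t ht => by
      linarith [ht.1]
    have h1 : ∀ t ∈ Set.Icc (2 * (m : ℝ) + 6) (2 * m + 10), t - 1 ≠ 0 := fun t ht => by
      linarith [ht.1]
    have hD : ∀ t ∈ Set.Icc (2 * (m : ℝ) + 6) (2 * m + 10), t ^ 2 - 6 * t + 7 ≠ 0 :=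
      fun t ht => by nlinarith [ht.1]
    fun_prop (disch := assumption)
  have hsub := intermediate_value_Icc' (by linarith) hcont
  suffices h₀ : (0 : ℝ) ∈ Set.Icc _ _ by
    obtain ⟨t, ht, h⟩ := hsub h₀
    exact ⟨t, by linarith [ht.1], by linarith⟩
  constructor
  · have e1 : 2 * (m : ℝ) / (2 * m + 10 - 3) ≤ 1 := by
      rw [div_le_one (by linarith)]; linarith
    have e2 : (4 * (2 * (m : ℝ) + 10) - 8) / ((2 * m + 10) ^ 2 - 6 * (2 * m + 10) + 7) ≤ 1 := by
      rw [div_le_one (by nlinarith)]; nlinarith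
    have e3 : 1 / (2 * (m : ℝ) + 10 - 1) ≤ 1 := by
      rw [div_le_one (by linarith)]; linarith
    linarith
  · have e1 : 2 * (m : ℝ) / (2 * m + 5) ≤ 2 * m / (2 * m + 6 - 3) :=
      div_le_div_of_nonneg_left (by linarith) (by linarith) (by linarith)
    have e2 : 4 / (2 * (m : ℝ) + 5) ≤
        (4 * (2 * (m : ℝ) + 6) - 8) / ((2 * m + 6) ^ 2 - 6 * (2 * m + 6) + 7) := by
      rw [div_le_div_iff₀ (by linarith) (by nlinarith)]; nlinarith
    have e3 : 2 * (m : ℝ) / (2 * m + 5) + 4 / (2 * (m : ℝ) + 5) + 1 / (2 * m + 6 - 1) = 1 := by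
      rw [show 2 * (m : ℝ) + 6 - 1 = 2 * m + 5 by ring, ← add_div, ← add_div,
        div_eq_one_iff_eq (by positivity)]
      ring
    linarith

theorem qIndex_path_lt_qIndex_star (m : ℕ) :
    qIndex (cone (dUnion (matching m) (dUnion (pathGraph 4) (pathGraph 1)))) <
      qIndex (cone (dUnion (matching m) (dUnion (starGraph 4) (pathGraph 1)))) := by
  obtain ⟨t, ht, hroot⟩ := exists_apex_root m
  have hD : 0 < t ^ 2 - 6 * t + 7 := by nlinarith
  have hE : 0 < t ^ 2 - 6 * t + 5 := by nlinarith
  have hD' := mul_inv_cancel₀ hD.ne'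
  have hE' := mul_inv_cancel₀ hE.ne'
  have ha : 0 < (t - 3) / (t ^ 2 - 6 * t + 7) := div_pos (by linarith) hD
  have hb : 0 < (t - 1) / (t ^ 2 - 6 * t + 7) := div_pos (by linarith) hD
  have hl : 0 < (t - 3) / (t ^ 2 - 6 * t + 5) := div_pos (by linarith) hE
  have hs : 0 < (t + 1) / (t ^ 2 - 6 * t + 5) := div_pos (by linarith) hE
  have hpath : qIndex (cone (dUnion (matching m) (dUnion (pathGraph 4) (pathGraph 1)))) ≤ t := by
    refine qIndex_le_of_mulVec_le (v := testVec m t ![(t - 3) / (t ^ 2 - 6 * t + 7),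
      (t - 1) / (t ^ 2 - 6 * t + 7), (t - 1) / (t ^ 2 - 6 * t + 7),
      (t - 3) / (t ^ 2 - 6 * t + 7)]) (by linarith) (testVec_pos (by linarith) ?_) ?_
    · intro i; fin_cases i <;> assumption
    · rintro (_ | a)
      · rw [signlessLap_testVec_none]
        simp only [testVec, mul_one]
        refine le_of_eq (Eq.trans ?_ hroot)
        simp
        ring
      · refine (signlessLap_testVec_some (by linarith) (fun i => ?_) a).le
        rw [signlessLap_pathGraph_four]
        fin_cases i <;> simp <;> linear_combination -hD'
  have hapex : t * testVec m t ![(t + 1) / (t ^ 2 - 6 * t + 5), (t - 3) / (t ^ 2 - 6 * t + 5),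
      (t - 3) / (t ^ 2 - 6 * t + 5), (t - 3) / (t ^ 2 - 6 * t + 5)] none <
      (signlessLap (cone (dUnion (matching m) (dUnion (starGraph 4) (pathGraph 1))))).mulVec
        (testVec m t ![(t + 1) / (t ^ 2 - 6 * t + 5), (t - 3) / (t ^ 2 - 6 * t + 5),
          (t - 3) / (t ^ 2 - 6 * t + 5), (t - 3) / (t ^ 2 - 6 * t + 5)]) none := by
    have hlt := div_lt_div_of_pos_left (show 0 < 4 * t - 8 by linarith) hE
      (show t ^ 2 - 6 * t + 5 < t ^ 2 - 6 * t + 7 by linarith)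
    have hsum : (t + 1) / (t ^ 2 - 6 * t + 5) + (t - 3) / (t ^ 2 - 6 * t + 5) +
        (t - 3) / (t ^ 2 - 6 * t + 5) + (t - 3) / (t ^ 2 - 6 * t + 5) =
        (4 * t - 8) / (t ^ 2 - 6 * t + 5) := by ring
    rw [signlessLap_testVec_none]
    change t * 1 < 2 * m + 5 + 2 * m / (t - 3) + ((t + 1) / (t ^ 2 - 6 * t + 5) +
      (t - 3) / (t ^ 2 - 6 * t + 5) + (t - 3) / (t ^ 2 - 6 * t + 5) +
      (t - 3) / (t ^ 2 - 6 * t + 5)) + 1 / (t - 1)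
    linarith
  refine hpath.trans_lt (lt_qIndex_of_le_mulVec (testVec_pos (by linarith) ?_) ?_ hapex)
  · intro i; fin_cases i <;> assumption
  · rintro (_ | a)
    · exact hapex.le
    · refine (signlessLap_testVec_some (by linarith) (fun i => ?_) a).ge
      rw [signlessLap_starGraph_four]
      fin_cases i <;> simp <;> linear_combination -hE'

theorem stmt13 (k : ℕ) (hk : 2 ≤ k) :
    qIndex (cone (dUnion (matching (k - 2)) (dUnion (starGraph 4) (pathGraph 1)))) > qIndex (cone (dUnion (matching (k - 2)) (dUnion (pathGraph 4) (pathGraph 1)))) := by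
  exact qIndex_path_lt_qIndex_star (k - 2)

end QPaper
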